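/- Fix X ∈ {0,1}^{m×n} and v ∈ {0,1}^n. Define u* ∈ {0,1}^m by u*_i = 1 if (X_{i:})·v > h(v)/2 and u*_i = 0 otherwise. Then for every u ∈ {0,1}^m, h(X ⊕ u*v^T) ≤ h(X ⊕ uv^T); i.e., the Proximus u-update globally minimizes the rank-one XOR approximation cost over u for fixed v. -/

import Mathlib

open Finset

/-- Hamming weight of a binary vector. -/
def hW {m : ℕ} (x : Fin m → Bool) : ℕ :=
  (univ.filter fun i => x i = true).card

/-- Hamming weight of a binary matrix. -/
def hM {m n : ℕ} (X : Fin m → Fin n → Bool) : ℕ :=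
  (univ.filter fun p : Fin m × Fin n => X p.1 p.2 = true).card

/-- Integer inner product of two binary vectors. -/
def dotB {m : ℕ} (x y : Fin m → Bool) : ℕ :=
  (univ.filter fun i => (x i && y i) = true).card

/-- Cost h(X ⊕ u vᵀ) of the rank-one XOR approximation. -/
def cost {m n : ℕ} (X : Fin m → Fin n → Bool) (u : Fin m → Bool) (v : Fin n → Bool) : ℕ :=
  hM (fun i j => xor (X i j) (u i && v j))

/-- The Hamming weight of a binary matrix is the sum of the Hamming weights of its rows. -/
theorem hM_eq_sum_hW {m n : ℕ} (X : Fin m → Fin n → Bool) : hM X = ∑ i, hW (X i) := by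
  simp only [hM, hW, card_filter]
  exact Fintype.sum_prod_type _

theorem hW_xor_add_two_mul_dotB {n : ℕ} (x y : Fin n → Bool) :
    hW (fun j => xor (x j) (y j)) + 2 * dotB x y = hW x + hW y := by
  simp only [hW, dotB, card_filter, mul_sum, ← sum_add_distrib]
  refine sum_congr rfl fun j _ => ?_
  cases x j <;> cases y j <;> rfl

/-- the Proximus u-update globally minimizes the rank-one XOR
approximation cost over u, for fixed v. -/
theorem proximus_u_update_global_min {m n : ℕ}
    (X : Fin m → Fin n → Bool) (v : Fin n → Bool)
    (ustar : Fin m → Bool)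
    (hustar : ∀ i, ustar i = decide ((dotB (X i) v : ℚ) > (hW v : ℚ) / 2)) :
    ∀ u : Fin m → Bool, cost X ustar v ≤ cost X u v := by
  intro u
  simp only [cost, hM_eq_sum_hW]
  refine sum_le_sum fun i _ => ?_
  have hrow := hW_xor_add_two_mul_dotB (X i) v
  have heta : hW (fun j => X i j) = hW (X i) := rfl
  have hiff : ustar i = true ↔ hW v < 2 * dotB (X i) v := by
    rw [hustar i, decide_eq_true_iff, gt_iff_lt, div_lt_iff₀' two_pos]
    exact_mod_cast Iff.rfl
  cases hs : ustar i <;> cases u i <;>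
    simp only [hs, Bool.false_and, Bool.true_and, Bool.xor_false, Bool.false_eq_true, false_iff,
      true_iff] at hiff ⊢ <;> omega
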